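/- Let x, y ∈ 𝒮 with c_0^x = c_0^y = a, and suppose there is l ∈ ℕ such that x_i = y_i for all i ≥ l+1. If v(a; x) = v(a; y), then x_i = y_i for all i ≥ 1. -/

import Mathlib

open scoped BigOperators
open IntermediateField Filter

/-- A substitution applied to a word (concatenation of the images of its letters). -/
def substW {A : Type*} (σ : A → List A) (w : List A) : List A := (w.map σ).flatten

/-- `σ^n(a)`: the `n`-th iterate of the substitution on the letter `a`. -/
def substIter {A : Type*} (σ : A → List A) (n : ℕ) (a : A) : List A := (substW σ)^[n] [a]

/-- `γ(w)`: the sum of `γ` over the letters of the word `w` (with `γ(ε) = 0`). -/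
def gammaW {A : Type*} (γ : A → ℝ) (w : List A) : ℝ := (w.map γ).sum

/-- The finite window `x_m x_{m+1} … x_{m+len-1}` of a two-sided sequence `x`. -/
def wordOf {A : Type*} (x : ℤ → A) (m : ℤ) (len : ℕ) : List A :=
  (List.range len).map (fun k => x (m + k))

/-- Membership in the subshift `X_σ`: every finite subword of `x` is a subword of
some `σ^N(a)`. -/
def InXsigma {A : Type*} (σ : A → List A) (x : ℤ → A) : Prop :=
  ∀ (m : ℤ) (len : ℕ), ∃ (N : ℕ) (a : A), (wordOf x m len) <:+: substIter σ N a

/-- `γ_n(x)`: equals `γ(x_0 … x_{n-1})` for `n > 0`, `0` for `n = 0`, and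
`γ(x_n … x_{-1})` for `n < 0`. -/
def gammaZ {A : Type*} (γ : A → ℝ) (x : ℤ → A) (n : ℤ) : ℝ :=
  if 0 ≤ n then gammaW γ (wordOf x 0 n.toNat) else gammaW γ (wordOf x n (-n).toNat)

/-- A minimal point: a point of `X_σ` with `γ_n(x) ≥ 0` for all `n ∈ ℤ`. -/
def IsMinimalPt {A : Type*} (σ : A → List A) (γ : A → ℝ) (x : ℤ → A) : Prop :=
  InXsigma σ x ∧ ∀ n : ℤ, 0 ≤ gammaZ γ x n

/-- Primitivity of a substitution: some power of `σ` applied to any letter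
contains every letter. -/
def Primitive {A : Type*} (σ : A → List A) : Prop :=
  ∃ N : ℕ, 0 < N ∧ ∀ a b : A, b ∈ substIter σ N a

/-- The set `𝒮` of admissible decomposition sequences `(p_i, c_i, s_i)_{i ∈ ℕ}`:
`σ(c_i) = p_{i+1} c_{i+1} s_{i+1}` for all `i ≥ 0`. -/
def SeqS {A : Type*} (σ : A → List A) (x : ℕ → List A × A × List A) : Prop :=
  ∀ i : ℕ, σ ((x i).2.1) = (x (i+1)).1 ++ (x (i+1)).2.1 :: (x (i+1)).2.2

/-- `v(a ; x) = Σ_{i ≥ 1} θ₂^{-i} γ(p_i)` (with `a = c_0^x`). -/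
noncomputable def vOf {A : Type*} (θ₂ : ℝ) (γ : A → ℝ) (x : ℕ → List A × A × List A) : ℝ :=
  ∑' i : ℕ, θ₂ ^ (-(i : ℤ) - 1) * gammaW γ ((x (i+1)).1)

/-- `v(a) = inf { v(a ; x) : x ∈ 𝒮, c_0^x = a }`. -/
noncomputable def vMin {A : Type*} (σ : A → List A) (θ₂ : ℝ) (γ : A → ℝ) (a : A) : ℝ :=
  sInf { v : ℝ | ∃ x : ℕ → List A × A × List A, SeqS σ x ∧ (x 0).2.1 = a ∧ v = vOf θ₂ γ x }

theorem gammaW_append {A : Type*} (γ : A → ℝ) (u w : List A) :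
    gammaW γ (u ++ w) = gammaW γ u + gammaW γ w := by
  simp [gammaW]

theorem gammaW_cons {A : Type*} (γ : A → ℝ) (c : A) (w : List A) :
    gammaW γ (c :: w) = γ c + gammaW γ w := by
  simp [gammaW]

theorem gammaW_nonneg {A : Type*} {γ : A → ℝ} (hγ : ∀ a, 0 ≤ γ a) (w : List A) :
    0 ≤ gammaW γ w := by
  refine List.sum_nonneg fun r hr => ?_
  obtain ⟨a, -, rfl⟩ := List.mem_map.1 hr
  exact hγ a

theorem abs_gammaW_le {A : Type*} (γ : A → ℝ) (w : List A) :
    |gammaW γ w| ≤ gammaW (fun a => |γ a|) w := by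
  induction w with
  | nil => simp [gammaW]
  | cons c w ih =>
    rw [gammaW_cons, gammaW_cons]
    exact (abs_add_le _ _).trans (by gcongr)

theorem gammaW_eq_sum_count {A : Type*} [Fintype A] [DecidableEq A] (γ : A → ℝ) (w : List A) :
    gammaW γ w = ∑ b : A, (w.count b : ℝ) * γ b := by
  induction w with
  | nil => simp [gammaW]
  | cons c w ih =>
    rw [gammaW_cons, ih]
    simp [List.count_cons, add_mul, Finset.sum_add_distrib, add_comm]

/-- Truncations of `v(a; x)`, for an arbitrary base and arbitrary weights on letters. -/
noncomputable def vTrunc {A : Type*} (θ : ℝ) (γ : A → ℝ) (n : ℕ)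
    (x : ℕ → List A × A × List A) : ℝ :=
  ∑ i ∈ Finset.range n, θ ^ (-(i : ℤ) - 1) * gammaW γ (x (i + 1)).1

theorem vTrunc_succ {A : Type*} {θ : ℝ} (hθ : θ ≠ 0) (γ : A → ℝ) (n : ℕ)
    (x : ℕ → List A × A × List A) :
    vTrunc θ γ (n + 1) x = θ⁻¹ * (gammaW γ (x 1).1 + vTrunc θ γ n (fun i => x (i + 1))) := by
  rw [vTrunc, Finset.sum_range_succ', mul_add, vTrunc, Finset.mul_sum, add_comm]
  congr 1
  · simp
  · refine Finset.sum_congr rfl fun i _ => ?_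
    rw [← mul_assoc, ← zpow_neg_one, ← zpow_add₀ hθ]
    congr 2
    push_cast
    ring

theorem vTrunc_lt {A : Type*} {σ : A → List A} {θ : ℝ} (hθ : 0 < θ) {γ : A → ℝ}
    (hγ : ∀ a, 0 < γ a) (heig : ∀ a, gammaW γ (σ a) = θ * γ a) (n : ℕ)
    {x : ℕ → List A × A × List A} (hx : SeqS σ x) :
    vTrunc θ γ n x < γ (x 0).2.1 := by
  induction n generalizing x with
  | zero => simpa [vTrunc] using hγ _
  | succ n ih =>
    have h := ih (x := fun i => x (i + 1)) fun i => hx (i + 1)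
    have h0 := heig (x 0).2.1
    rw [hx 0, gammaW_append, gammaW_cons] at h0
    have hs := gammaW_nonneg (fun a => (hγ a).le) (x (0 + 1)).2.2
    rw [vTrunc_succ hθ.ne', inv_mul_lt_iff₀ hθ]
    simp only [zero_add] at *
    linarith

/-- A strictly shorter first prefix gives strictly smaller truncations. -/
theorem vTrunc_lt_vTrunc {A : Type*} {σ : A → List A} {θ : ℝ} (hθ : 0 < θ) {γ : A → ℝ}
    (hγ : ∀ a, 0 < γ a) (heig : ∀ a, gammaW γ (σ a) = θ * γ a) (n : ℕ)
    {x y : ℕ → List A × A × List A} (hx : SeqS σ x) (hy : SeqS σ y)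
    (h0 : (x 0).2.1 = (y 0).2.1) (hlen : (x 1).1.length < (y 1).1.length) :
    vTrunc θ γ (n + 1) x < vTrunc θ γ (n + 1) y := by
  have hx1 : (x 1).1 ++ [(x 1).2.1] <+: (y 1).1 := by
    refine List.prefix_of_prefix_length_le (l₃ := σ (x 0).2.1) ?_ ?_ (by simpa using hlen)
    · exact ⟨(x 1).2.2, by simpa using (hx 0).symm⟩
    · exact ⟨(y 1).2.1 :: (y 1).2.2, by simpa [h0] using (hy 0).symm⟩
  obtain ⟨w, hw⟩ := hx1
  have hnn : ∀ a, 0 ≤ γ a := fun a => (hγ a).le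
  have htail := vTrunc_lt hθ hγ heig n (x := fun i => x (i + 1)) fun i => hx (i + 1)
  have hy_nonneg : 0 ≤ vTrunc θ γ n (fun i => y (i + 1)) :=
    Finset.sum_nonneg fun i _ => mul_nonneg (by positivity) (gammaW_nonneg hnn _)
  have hw_nonneg := gammaW_nonneg hnn w
  rw [vTrunc_succ hθ.ne', vTrunc_succ hθ.ne', ← hw]
  have hc : gammaW γ [(x 1).2.1] = γ (x 1).2.1 := by simp [gammaW]
  rw [gammaW_append, gammaW_append, hc]
  refine mul_lt_mul_of_pos_left ?_ (by positivity)
  simp only [zero_add] at htail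
  linarith

theorem eq_of_vTrunc_eq {A : Type*} {σ : A → List A} {θ : ℝ} (hθ : 0 < θ) {γ : A → ℝ}
    (hγ : ∀ a, 0 < γ a) (heig : ∀ a, gammaW γ (σ a) = θ * γ a) (n : ℕ)
    {x y : ℕ → List A × A × List A} (hx : SeqS σ x) (hy : SeqS σ y)
    (h0 : (x 0).2.1 = (y 0).2.1) (h : vTrunc θ γ n x = vTrunc θ γ n y) :
    ∀ i < n, x (i + 1) = y (i + 1) := by
  induction n generalizing x y with
  | zero => simp
  | succ n ih =>
    rcases lt_trichotomy (x 1).1.length (y 1).1.length with hlt | heq | hlt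
    · exact absurd h (vTrunc_lt_vTrunc hθ hγ heig n hx hy h0 hlt).ne
    · have hdec := (hx 0).symm.trans ((congrArg σ h0).trans (hy 0))
      obtain ⟨hp, hcs⟩ := List.append_inj hdec heq
      obtain ⟨hc, hs⟩ := List.cons.inj hcs
      have h1 : x 1 = y 1 := Prod.ext hp (Prod.ext hc hs)
      rw [vTrunc_succ hθ.ne', vTrunc_succ hθ.ne', h1] at h
      have h' := add_left_cancel (mul_left_cancel₀ (inv_ne_zero hθ.ne') h)
      have hrec := ih (x := fun i => x (i + 1)) (y := fun i => y (i + 1))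
        (fun i => hx (i + 1)) (fun i => hy (i + 1)) hc h'
      rintro (_ | i) hi
      · exact h1
      · exact hrec i (by omega)
    · exact absurd h (vTrunc_lt_vTrunc hθ hγ heig n hy hx h0.symm hlt).ne'

theorem SeqS.summable {A : Type*} [Fintype A] {σ : A → List A} {θ : ℝ} (hθ : 1 < θ) (γ : A → ℝ)
    {x : ℕ → List A × A × List A} (hx : SeqS σ x) :
    Summable fun i : ℕ => θ ^ (-(i : ℤ) - 1) * gammaW γ (x (i + 1)).1 := by
  have hθ0 : 0 < θ := by linarith
  set C := ∑ a : A, gammaW (fun b => |γ b|) (σ a)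
  have hnn := gammaW_nonneg (γ := fun b => |γ b|) fun b => abs_nonneg _
  refine Summable.of_norm_bounded (g := fun i : ℕ => θ⁻¹ ^ i * (θ⁻¹ * C)) ?_ fun i => ?_
  · exact (summable_geometric_of_lt_one (by positivity) (inv_lt_one_of_one_lt₀ hθ)).mul_right _
  · have hz : θ ^ (-(i : ℤ) - 1) = θ⁻¹ ^ i * θ⁻¹ := by
      rw [zpow_sub₀ hθ0.ne', zpow_neg, zpow_natCast, zpow_one, inv_pow, div_eq_mul_inv]
    rw [norm_mul, Real.norm_of_nonneg (by positivity), hz, mul_assoc, Real.norm_eq_abs]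
    have hσ : gammaW (fun b => |γ b|) (σ (x i).2.1) ≤ C :=
      Finset.single_le_sum (f := fun a => gammaW (fun b => |γ b|) (σ a))
        (fun a _ => hnn _) (Finset.mem_univ _)
    rw [hx i, gammaW_append] at hσ
    have h1 := abs_gammaW_le γ (x (i + 1)).1
    have h2 := hnn ((x (i + 1)).2.1 :: (x (i + 1)).2.2)
    gcongr
    linarith

theorem vTrunc_eq_of_vOf_eq {A : Type*} [Fintype A] {σ : A → List A} {θ : ℝ} (hθ : 1 < θ)
    {γ : A → ℝ} {x y : ℕ → List A × A × List A} (hx : SeqS σ x) (hy : SeqS σ y) {l : ℕ}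
    (htail : ∀ i : ℕ, l + 1 ≤ i → x i = y i) (h : vOf θ γ x = vOf θ γ y) :
    vTrunc θ γ l x = vTrunc θ γ l y := by
  rw [vOf, vOf, ← (hx.summable hθ γ).sum_add_tsum_nat_add l,
    ← (hy.summable hθ γ).sum_add_tsum_nat_add l] at h
  simp_rw [fun i => htail (i + l + 1) (by omega)] at h
  exact add_right_cancel h

theorem map_vTrunc {A K : Type*} [Field K] (f : K →+* ℝ) (t : K) (lam : A → K) (n : ℕ)
    (x : ℕ → List A × A × List A) :
    f (∑ i ∈ Finset.range n, t ^ (-(i : ℤ) - 1) * ((x (i + 1)).1.map lam).sum) =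
      vTrunc (f t) (fun a => f (lam a)) n x := by
  simp only [vTrunc, gammaW, map_sum, map_mul, map_zpow₀, map_list_sum, List.map_map]
  rfl

/-- Lemma 3.11 of the paper: two sequences of `𝒮` with the same
`c_0`, equal tails from index `l+1` on, and the same value of `v(a ; ·)`, coincide
from index `1` on. -/
theorem statement_13 {A : Type*} [Fintype A] [DecidableEq A]
    (σ : A → List A) (hσ : ∀ a, σ a ≠ [])
    (hprim : Primitive σ)
    (hMpos : ∀ a b : A, 0 < (σ a).count b)
    (θ₁ θ₂ : ℝ) (hθ₁alg : IsAlgebraic ℚ θ₁)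
    (hθ₂1 : 1 < θ₂) (hθ₂θ₁ : θ₂ < θ₁)
    (hconj : Polynomial.aeval θ₂ (minpoly ℚ θ₁) = 0)
    (lam : A → ℚ⟮θ₁⟯) (hlampos : ∀ a, (0:ℝ) < (lam a : ℝ))
    (heig1 : ∀ a, ∑ b : A, ((σ a).count b : ℝ) * (lam b : ℝ) = θ₁ * (lam a : ℝ))
    (η : ℚ⟮θ₁⟯ →ₐ[ℚ] ℝ) (hη : η (AdjoinSimple.gen ℚ θ₁) = θ₂)
    (γ : A → ℝ) (hγ : ∀ a, γ a = η (lam a))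
    (heig2 : ∀ a, ∑ b : A, ((σ a).count b : ℝ) * γ b = θ₂ * γ a)
    (x y : ℕ → List A × A × List A) (hx : SeqS σ x) (hy : SeqS σ y)
    (a : A) (hx0 : (x 0).2.1 = a) (hy0 : (y 0).2.1 = a)
    (l : ℕ) (htail : ∀ i : ℕ, l + 1 ≤ i → x i = y i)
    (hval : vOf θ₂ γ x = vOf θ₂ γ y) :
    ∀ i : ℕ, 1 ≤ i → x i = y i := by
  have hvθ₂ := vTrunc_eq_of_vOf_eq hθ₂1 hx hy htail hval
  have hvθ₁ : vTrunc θ₁ (fun a => (lam a : ℝ)) l x = vTrunc θ₁ (fun a => (lam a : ℝ)) l y := by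
    have hx₂ := map_vTrunc (η : ℚ⟮θ₁⟯ →+* ℝ) (AdjoinSimple.gen ℚ θ₁) lam l x
    have hy₂ := map_vTrunc (η : ℚ⟮θ₁⟯ →+* ℝ) (AdjoinSimple.gen ℚ θ₁) lam l y
    have hx₁ := map_vTrunc (algebraMap ℚ⟮θ₁⟯ ℝ) (AdjoinSimple.gen ℚ θ₁) lam l x
    have hy₁ := map_vTrunc (algebraMap ℚ⟮θ₁⟯ ℝ) (AdjoinSimple.gen ℚ θ₁) lam l y
    simp only [RingHom.coe_coe, hη, ← hγ] at hx₂ hy₂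
    rw [AdjoinSimple.algebraMap_gen] at hx₁ hy₁
    refine hx₁.symm.trans (Eq.trans (congrArg _ ?_) hy₁)
    exact η.injective (hx₂.trans (hvθ₂.trans hy₂.symm))
  have heq := eq_of_vTrunc_eq (by linarith) hlampos
    (fun a => (gammaW_eq_sum_count _ _).trans (heig1 a)) l hx hy (hx0.trans hy0.symm) hvθ₁
  intro i hi
  rcases le_or_gt (l + 1) i with hli | hli
  · exact htail i hli
  · obtain ⟨j, rfl⟩ := Nat.exists_eq_add_of_le' hi
    exact heq j (by omega)
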